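/- arXiv:2512.12335 — 5 statements merged into one kernel-verified Lean document; each statement's English description precedes it below -/
import Mathlib

section
/- For every E-linear code C of length n, the residue and torsion codes of its left dual both equal the Euclidean dual of the residue code of C: (C^{⊥L})_Res = (C_Res)^⊥ and (C^{⊥L})_Tor = (C_Res)^⊥. -/
open scoped BigOperators

/-- The non-unital ring `E` of order 4: the pair `(u, v)` represents `uκ + vζ`,
where `ζ = κ + τ`.  Multiplication: `(uκ + vζ)·(u'κ + v'ζ) = u'·(uκ + vζ)`. -/
def RingE : Type := ZMod 2 × ZMod 2

namespace RingE

instance : AddCommGroup RingE := inferInstanceAs (AddCommGroup (ZMod 2 × ZMod 2))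

instance : Mul RingE := ⟨fun a b => Prod.mk (Prod.fst a * Prod.fst b) (Prod.snd a * Prod.fst b)⟩

noncomputable instance : DecidableEq RingE := Classical.decEq _

instance : NonUnitalRing RingE where
  left_distrib a b c := by
    show Prod.mk (Prod.fst a * (Prod.fst b + Prod.fst c))
        (Prod.snd a * (Prod.fst b + Prod.fst c)) = _
    show _ = Prod.mk (Prod.fst a * Prod.fst b + Prod.fst a * Prod.fst c)
        (Prod.snd a * Prod.fst b + Prod.snd a * Prod.fst c)
    simp [mul_add]
  right_distrib a b c := by
    show Prod.mk ((Prod.fst a + Prod.fst b) * Prod.fst c)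
        ((Prod.snd a + Prod.snd b) * Prod.fst c) = _
    show _ = Prod.mk (Prod.fst a * Prod.fst c + Prod.fst b * Prod.fst c)
        (Prod.snd a * Prod.fst c + Prod.snd b * Prod.fst c)
    simp [add_mul]
  zero_mul a := by
    show Prod.mk ((0 : ZMod 2) * Prod.fst a) ((0 : ZMod 2) * Prod.fst a) = ((0 : ZMod 2), (0 : ZMod 2))
    simp
  mul_zero a := by
    show Prod.mk (Prod.fst a * (0 : ZMod 2)) (Prod.snd a * (0 : ZMod 2)) = ((0 : ZMod 2), (0 : ZMod 2))
    simp
  mul_assoc a b c := by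
    show Prod.mk (Prod.fst a * Prod.fst b * Prod.fst c) (Prod.snd a * Prod.fst b * Prod.fst c)
      = Prod.mk (Prod.fst a * (Prod.fst b * Prod.fst c)) (Prod.snd a * (Prod.fst b * Prod.fst c))
    simp [mul_assoc]

/-- The generator `κ`. -/
def kappa : RingE := Prod.mk 1 0

/-- The generator `τ`. -/
def tau : RingE := Prod.mk 1 1

/-- `ζ = κ + τ`. -/
def zeta : RingE := Prod.mk 0 1

/-- The reduction map `π : E → F₂`, sending `uκ + vζ` to `u`. -/
def pi (a : RingE) : ZMod 2 := Prod.fst a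

/-- `κ·c` for a scalar `c ∈ F₂`, i.e. the element `cκ` of `E`. -/
def kappaSMul (c : ZMod 2) : RingE := Prod.mk c 0

/-- `ζ·c` for a scalar `c ∈ F₂`, i.e. the element `cζ` of `E`. -/
def zetaSMul (c : ZMod 2) : RingE := Prod.mk 0 c

end RingE

namespace ECode

/-- Componentwise reduction `π : Eⁿ → F₂ⁿ`. -/
def piVec {n : ℕ} (x : Fin n → RingE) : Fin n → ZMod 2 := fun i => RingE.pi (x i)

/-- The vector `κv ∈ Eⁿ` attached to `v ∈ F₂ⁿ`. -/
def kappaVec {n : ℕ} (v : Fin n → ZMod 2) : Fin n → RingE := fun i => RingE.kappaSMul (v i)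

/-- The vector `ζv ∈ Eⁿ` attached to `v ∈ F₂ⁿ`. -/
def zetaVec {n : ℕ} (v : Fin n → ZMod 2) : Fin n → RingE := fun i => RingE.zetaSMul (v i)

/-- An `E`-linear code of length `n`: a left `E`-submodule of `Eⁿ`, i.e. an additive
subgroup closed under componentwise left multiplication by elements of `E`. -/
def IsECode {n : ℕ} (C : Set (Fin n → RingE)) : Prop :=
  (0 : Fin n → RingE) ∈ C ∧ (∀ x ∈ C, ∀ y ∈ C, x + y ∈ C) ∧ (∀ x ∈ C, -x ∈ C) ∧
    ∀ (a : RingE), ∀ x ∈ C, (fun i => a * x i) ∈ C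

/-- The residue code `C_Res = π(C)`. -/
def Res {n : ℕ} (C : Set (Fin n → RingE)) : Set (Fin n → ZMod 2) := piVec '' C

/-- The torsion code `C_Tor = {v ∈ F₂ⁿ : ζv ∈ C}`. -/
def Tor {n : ℕ} (C : Set (Fin n → RingE)) : Set (Fin n → ZMod 2) := {v | zetaVec v ∈ C}

/-- A code is free if its residue and torsion codes coincide. -/
def IsFree {n : ℕ} (C : Set (Fin n → RingE)) : Prop := Res C = Tor C

/-- The inner product on `Eⁿ`. -/
def Einner {n : ℕ} (w z : Fin n → RingE) : RingE := ∑ i, w i * z i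

/-- The left dual `C^{⊥L}`. -/
def dualL {n : ℕ} (C : Set (Fin n → RingE)) : Set (Fin n → RingE) :=
  {z | ∀ w ∈ C, Einner z w = 0}

/-- The right dual `C^{⊥R}`. -/
def dualR {n : ℕ} (C : Set (Fin n → RingE)) : Set (Fin n → RingE) :=
  {z | ∀ w ∈ C, Einner w z = 0}

/-- The (two-sided) dual `C^⊥ = C^{⊥L} ∩ C^{⊥R}`. -/
def dualE {n : ℕ} (C : Set (Fin n → RingE)) : Set (Fin n → RingE) := dualL C ∩ dualR C

/-- The left hull `LHull(C) = C ∩ C^{⊥L}`. -/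
def LHull {n : ℕ} (C : Set (Fin n → RingE)) : Set (Fin n → RingE) := C ∩ dualL C

/-- The right hull `RHull(C) = C ∩ C^{⊥R}`. -/
def RHull {n : ℕ} (C : Set (Fin n → RingE)) : Set (Fin n → RingE) := C ∩ dualR C

/-- The hull `Hull(C) = C ∩ C^⊥`. -/
def EHull {n : ℕ} (C : Set (Fin n → RingE)) : Set (Fin n → RingE) := C ∩ dualE C

/-- The Euclidean inner product on `F₂ⁿ`. -/
def Finner {n : ℕ} (w z : Fin n → ZMod 2) : ZMod 2 := ∑ i, w i * z i

/-- The Euclidean dual of an `F₂`-linear code. -/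
def dualF {n : ℕ} (B : Set (Fin n → ZMod 2)) : Set (Fin n → ZMod 2) :=
  {z | ∀ w ∈ B, Finner w z = 0}

/-- The hull of an `F₂`-linear code. -/
def FHull {n : ℕ} (B : Set (Fin n → ZMod 2)) : Set (Fin n → ZMod 2) := B ∩ dualF B

/-- `F₂`-dimension of an `F₂`-linear code (as the dimension of its span). -/
noncomputable def dimF {n : ℕ} (B : Set (Fin n → ZMod 2)) : ℕ :=
  Module.finrank (ZMod 2) (Submodule.span (ZMod 2) B)

/-- Scalar multiplication of a vector of `Eⁿ` by `a ∈ E`. -/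
def smulVec {n : ℕ} (a : RingE) (x : Fin n → RingE) : Fin n → RingE := fun i => a * x i

/-- The left `E`-span `⟨X⟩_E` of a finite set `X ⊆ Eⁿ`. -/
def spanE {n : ℕ} (X : Finset (Fin n → RingE)) : Set (Fin n → RingE) :=
  {y | ∃ c : (Fin n → RingE) → RingE, y = ∑ x ∈ X, smulVec (c x) x}

/-- The additive (`F₂`-) span `⟨X⟩_{F₂}` of a finite set `X ⊆ Eⁿ`: all sums of subsets. -/
def spanF {n : ℕ} (X : Finset (Fin n → RingE)) : Set (Fin n → RingE) :=
  {y | ∃ S : Finset (Fin n → RingE), S ⊆ X ∧ y = ∑ x ∈ S, x}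

/-- `X` is a generating set of the code `D` if `⟨X⟩_E ∪ ⟨X⟩_{F₂} = D`. -/
def IsGenSet {n : ℕ} (X : Finset (Fin n → RingE)) (D : Set (Fin n → RingE)) : Prop :=
  spanE X ∪ spanF X = D

/-- The rank of a (free) code: the minimum cardinality of a generating set. -/
noncomputable def genRank {n : ℕ} (D : Set (Fin n → RingE)) : ℕ :=
  sInf {m | ∃ X : Finset (Fin n → RingE), X.card = m ∧ IsGenSet X D}

/-- Prepending two coordinates to a vector of length `n`. -/
def cons2 {n : ℕ} (a b : RingE) (x : Fin n → RingE) : Fin (n + 2) → RingE :=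
  Fin.cons a (Fin.cons b x)

end ECode

theorem ECode.Einner_eq {n : ℕ} (z w : Fin n → RingE) :
    ECode.Einner z w = Prod.mk (∑ i, (z i).1 * (w i).1) (∑ i, (z i).2 * (w i).1) := by
  have h1 : ∀ s : Finset (Fin n), ∑ i ∈ s, z i * w i =
      (Prod.mk (∑ i ∈ s, (z i).1 * (w i).1) (∑ i ∈ s, (z i).2 * (w i).1) : RingE) := by
    intro s
    classical
    induction s using Finset.induction_on with
    | empty => rfl
    | insert a s ha ih =>
      rw [Finset.sum_insert ha, Finset.sum_insert ha, Finset.sum_insert ha, ih]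
      rfl
  exact h1 Finset.univ

theorem ECode.Einner_zero_iff {n : ℕ} (z w : Fin n → RingE) :
    ECode.Einner z w = 0 ↔
      ∑ i, (w i).1 * (z i).1 = 0 ∧ ∑ i, (w i).1 * (z i).2 = 0 := by
  rw [ECode.Einner_eq]
  simp only [mul_comm (Prod.fst (w _))]
  exact Prod.mk_inj

open ECode in
/-- For every `E`-linear code `C` of length `n`,
`(C^{⊥L})_Res = (C_Res)^⊥` and `(C^{⊥L})_Tor = (C_Res)^⊥`. -/
theorem residue_torsion_of_dualL {n : ℕ} (C : Set (Fin n → RingE)) (hC : IsECode C) :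
    Res (dualL C) = dualF (Res C) ∧ Tor (dualL C) = dualF (Res C) := by
  refine ⟨Set.ext fun v => ⟨?_, ?_⟩, Set.ext fun v => ⟨?_, ?_⟩⟩
  · rintro ⟨z, hz, rfl⟩ _ ⟨w, hw, rfl⟩
    exact ((Einner_zero_iff z w).1 (hz w hw)).1
  · intro hv
    refine ⟨kappaVec v, fun w hw => (Einner_zero_iff _ w).2 ⟨hv _ ⟨w, hw, rfl⟩, ?_⟩, rfl⟩
    exact Finset.sum_eq_zero fun i _ => mul_zero _
  · rintro hz _ ⟨w, hw, rfl⟩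
    exact ((Einner_zero_iff _ w).1 (hz w hw)).2
  · intro hv w hw
    refine (Einner_zero_iff _ w).2 ⟨?_, hv _ ⟨w, hw, rfl⟩⟩
    exact Finset.sum_eq_zero fun i _ => mul_zero _
end

section
/- For every E-linear code C of length n: (C^{⊥R})_Res = (C_Tor)^⊥, (C^{⊥R})_Tor = F₂ⁿ, (C^⊥)_Res = (C_Tor)^⊥, and (C^⊥)_Tor = (C_Res)^⊥. -/
open scoped BigOperators

namespace ECode

theorem einner_eq {n : ℕ} (w z : Fin n → RingE) :
    Einner w z = (Prod.mk (∑ i, (w i).1 * (z i).1) (∑ i, (w i).2 * (z i).1) : ZMod 2 × ZMod 2) := by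
  have h : ∀ s : Finset (Fin n), (∑ i ∈ s, w i * z i : RingE) =
      (Prod.mk (∑ i ∈ s, (w i).1 * (z i).1) (∑ i ∈ s, (w i).2 * (z i).1) : ZMod 2 × ZMod 2) := by
    intro s
    induction s using Finset.induction_on with
    | empty => simp; rfl
    | insert a s ha ih =>
      rw [Finset.sum_insert ha, Finset.sum_insert ha, Finset.sum_insert ha, ih]; rfl
  exact h _

theorem einner_zero_iff {n : ℕ} (w z : Fin n → RingE) :
    Einner w z = 0 ↔ Finner (fun i => (w i).1) (piVec z) = 0 ∧
      Finner (fun i => (w i).2) (piVec z) = 0 := by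
  rw [einner_eq]
  exact Prod.mk_inj

theorem fst_mem_tor {n : ℕ} {C : Set (Fin n → RingE)} (hC : IsECode C) {w : Fin n → RingE}
    (hw : w ∈ C) : (fun i => (w i).1) ∈ Tor C := by
  have h := hC.2.2.2 RingE.zeta w hw
  have e : zetaVec (fun i => (w i).1) = fun i => RingE.zeta * w i := by
    funext i
    show Prod.mk (0 : ZMod 2) (w i).1 = Prod.mk (0 * (w i).1) (1 * (w i).1)
    simp
  show zetaVec _ ∈ C
  rw [e]; exact h

theorem snd_mem_tor {n : ℕ} {C : Set (Fin n → RingE)} (hC : IsECode C) {w : Fin n → RingE}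
    (hw : w ∈ C) : (fun i => (w i).2) ∈ Tor C := by
  have h := hC.2.1 _ hw _ (hC.2.2.1 _ (hC.2.2.2 RingE.kappa w hw))
  have e : zetaVec (fun i => (w i).2) = w + -(fun i => RingE.kappa * w i) := by
    funext i
    show Prod.mk (0 : ZMod 2) (w i).2 =
      Prod.mk ((w i).1 + -(1 * (w i).1)) ((w i).2 + -(0 * (w i).1))
    simp [CharTwo.add_self_eq_zero]
  show zetaVec _ ∈ C
  rw [e]; exact h

theorem mem_dualR_iff {n : ℕ} {C : Set (Fin n → RingE)} (hC : IsECode C) (z : Fin n → RingE) :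
    z ∈ dualR C ↔ piVec z ∈ dualF (Tor C) := by
  constructor
  · intro h v hv
    exact ((einner_zero_iff _ _).1 (h _ hv)).2
  · intro h w hw
    exact (einner_zero_iff _ _).2 ⟨h _ (fst_mem_tor hC hw), h _ (snd_mem_tor hC hw)⟩

theorem finner_comm {n : ℕ} (v w : Fin n → ZMod 2) : Finner v w = Finner w v :=
  Finset.sum_congr rfl fun _ _ => mul_comm _ _

theorem finner_zero {n : ℕ} (v : Fin n → ZMod 2) : Finner v (fun _ => 0) = 0 := by
  simp [Finner]

theorem mem_dualL_iff {n : ℕ} {C : Set (Fin n → RingE)} (z : Fin n → RingE) :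
    z ∈ dualL C ↔ piVec z ∈ dualF (Res C) ∧ (fun i => (z i).2) ∈ dualF (Res C) := by
  constructor
  · intro h
    constructor
    · rintro _ ⟨w, hw, rfl⟩
      rw [finner_comm]; exact ((einner_zero_iff _ _).1 (h w hw)).1
    · rintro _ ⟨w, hw, rfl⟩
      rw [finner_comm]; exact ((einner_zero_iff _ _).1 (h w hw)).2
  · rintro ⟨h1, h2⟩ w hw
    refine (einner_zero_iff _ _).2 ⟨?_, ?_⟩
    · rw [finner_comm]; exact h1 _ ⟨w, hw, rfl⟩
    · rw [finner_comm]; exact h2 _ ⟨w, hw, rfl⟩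

end ECode

open ECode in
/-- For every `E`-linear code `C` of length `n`,
`(C^{⊥R})_Res = (C_Tor)^⊥`, `(C^{⊥R})_Tor = F₂ⁿ`, `(C^⊥)_Res = (C_Tor)^⊥`, and
`(C^⊥)_Tor = (C_Res)^⊥`. -/
theorem residue_torsion_of_dualR_dual {n : ℕ} (C : Set (Fin n → RingE)) (hC : IsECode C) :
    Res (dualR C) = dualF (Tor C) ∧ Tor (dualR C) = Set.univ ∧
      Res (dualE C) = dualF (Tor C) ∧ Tor (dualE C) = dualF (Res C) := by
  have hz : ∀ B : Set (Fin n → ZMod 2), (fun _ => 0) ∈ dualF B := fun B w _ => finner_zero w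
  refine ⟨?_, ?_, ?_, ?_⟩
  · ext v
    constructor
    · rintro ⟨z, hz, rfl⟩
      exact (mem_dualR_iff hC z).1 hz
    · intro hv
      exact ⟨kappaVec v, (mem_dualR_iff hC _).2 hv, rfl⟩
  · ext v
    exact ⟨fun _ => trivial, fun _ => (mem_dualR_iff hC _).2 (hz _)⟩
  · ext v
    constructor
    · rintro ⟨z, hz, rfl⟩
      exact (mem_dualR_iff hC z).1 hz.2
    · intro hv
      refine ⟨kappaVec v, ⟨(mem_dualL_iff _).2 ⟨?_, hz _⟩, (mem_dualR_iff hC _).2 hv⟩, rfl⟩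
      rintro _ ⟨w, hw, rfl⟩
      exact hv _ (fst_mem_tor hC hw)
  · ext v
    constructor
    · intro h
      exact ((mem_dualL_iff _).1 h.1).2
    · intro hv
      exact ⟨(mem_dualL_iff _).2 ⟨hz _, hv⟩, (mem_dualR_iff hC _).2 (hz _)⟩
end

section
/- For every E-linear code C of length n, the left hull LHull(C) = C ∩ C^{⊥L} satisfies (LHull(C))_Res = C_Res ∩ (C_Res)^⊥ and (LHull(C))_Tor = (C_Res)^⊥ ∩ C_Tor. -/
open scoped BigOperators

/-- The inner product on `Eⁿ` in coordinates. -/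
theorem aux_Einner_eq {n : ℕ} (z w : Fin n → RingE) :
    ECode.Einner z w = (Prod.mk (∑ i, Prod.fst (z i) * Prod.fst (w i))
      (∑ i, Prod.snd (z i) * Prod.fst (w i)) : ZMod 2 × ZMod 2) := by
  have h1 : ∀ s : Finset (Fin n), (∑ i ∈ s, z i * w i : RingE) =
      (Prod.mk (∑ i ∈ s, Prod.fst (z i) * Prod.fst (w i))
        (∑ i ∈ s, Prod.snd (z i) * Prod.fst (w i)) : ZMod 2 × ZMod 2) := by
    classical
    intro s
    induction s using Finset.induction_on with
    | empty => rfl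
    | insert a s ha ih =>
      rw [Finset.sum_insert ha, Finset.sum_insert ha, Finset.sum_insert ha, ih]
      rfl
  exact h1 Finset.univ

theorem aux_Einner_eq_zero {n : ℕ} (z w : Fin n → RingE) :
    ECode.Einner z w = 0 ↔ (∑ i, Prod.fst (z i) * Prod.fst (w i) = 0 ∧
      ∑ i, Prod.snd (z i) * Prod.fst (w i) = 0) := by
  rw [aux_Einner_eq]
  exact Prod.ext_iff

open ECode in
/-- `(LHull C)_Res = C_Res ∩ (C_Res)^⊥` and `(LHull C)_Tor = (C_Res)^⊥ ∩ C_Tor`. -/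
theorem residue_torsion_of_LHull {n : ℕ} (C : Set (Fin n → RingE)) (hC : IsECode C) :
    Res (LHull C) = Res C ∩ dualF (Res C) ∧ Tor (LHull C) = dualF (Res C) ∩ Tor C := by
  obtain ⟨-, -, -, hmul⟩ := hC
  constructor
  · ext v
    constructor
    · rintro ⟨x, ⟨hx, hd⟩, rfl⟩
      refine ⟨⟨x, hx, rfl⟩, ?_⟩
      rintro _ ⟨w, hw, rfl⟩
      have h := ((aux_Einner_eq_zero x w).1 (hd w hw)).1
      rw [← h]
      exact Finset.sum_congr rfl fun i _ => mul_comm _ _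
    · rintro ⟨⟨x, hx, rfl⟩, hd⟩
      refine ⟨fun i => RingE.kappa * x i, ⟨hmul _ x hx, ?_⟩, ?_⟩
      · intro w hw
        rw [aux_Einner_eq_zero]
        constructor
        · rw [← hd _ ⟨w, hw, rfl⟩]
          refine Finset.sum_congr rfl fun i _ => ?_
          change (1 * Prod.fst (x i)) * Prod.fst (w i) = Prod.fst (w i) * Prod.fst (x i)
          rw [one_mul, mul_comm]
        · refine Finset.sum_eq_zero fun i _ => ?_
          change (0 * Prod.fst (x i)) * Prod.fst (w i) = 0
          rw [zero_mul, zero_mul]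
      · funext i
        change 1 * Prod.fst (x i) = Prod.fst (x i)
        rw [one_mul]
  · ext v
    constructor
    · rintro ⟨hx, hd⟩
      refine ⟨?_, hx⟩
      rintro _ ⟨w, hw, rfl⟩
      have h := ((aux_Einner_eq_zero _ w).1 (hd w hw)).2
      rw [← h]
      exact Finset.sum_congr rfl fun i _ => mul_comm _ _
    · rintro ⟨hd, hx⟩
      refine ⟨hx, fun w hw => ?_⟩
      rw [aux_Einner_eq_zero]
      constructor
      · exact Finset.sum_eq_zero fun i _ => zero_mul _
      · rw [← hd _ ⟨w, hw, rfl⟩]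
        exact Finset.sum_congr rfl fun i _ => mul_comm _ _
end

section
/- For every E-linear code C of length n, the right hull RHull(C) = C ∩ C^{⊥R} satisfies (RHull(C))_Res = C_Res ∩ (C_Tor)^⊥ and (RHull(C))_Tor = C_Tor. -/
open scoped BigOperators

namespace ECode

/-- First coordinate as an additive map. -/
def fstHom : RingE →+ ZMod 2 := AddMonoidHom.fst (ZMod 2) (ZMod 2)

/-- Second coordinate as an additive map. -/
def sndHom : RingE →+ ZMod 2 := AddMonoidHom.snd (ZMod 2) (ZMod 2)

/-- Coordinatewise second component. -/
def sndVec {n : ℕ} (x : Fin n → RingE) : Fin n → ZMod 2 := fun i => sndHom (x i)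

theorem Einner_fst {n : ℕ} (w z : Fin n → RingE) :
    fstHom (Einner w z) = Finner (piVec w) (piVec z) := by
  unfold Einner Finner
  rw [map_sum]
  rfl

theorem Einner_snd {n : ℕ} (w z : Fin n → RingE) :
    sndHom (Einner w z) = Finner (sndVec w) (piVec z) := by
  unfold Einner Finner
  rw [map_sum]
  rfl

theorem Einner_eq_zero_iff {n : ℕ} (w z : Fin n → RingE) :
    Einner w z = 0 ↔ Finner (piVec w) (piVec z) = 0 ∧ Finner (sndVec w) (piVec z) = 0 := by
  rw [← Einner_fst, ← Einner_snd]
  constructor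
  · intro h
    rw [h]
    exact ⟨map_zero _, map_zero _⟩
  · rintro ⟨h1, h2⟩
    exact Prod.ext h1 h2

theorem piVec_mem_Tor {n : ℕ} {C : Set (Fin n → RingE)} (hC : IsECode C) {w : Fin n → RingE}
    (hw : w ∈ C) : piVec w ∈ Tor C := by
  have h := hC.2.2.2 RingE.zeta w hw
  have e : (fun i => RingE.zeta * w i) = zetaVec (piVec w) := by
    funext i
    exact Prod.ext (zero_mul (Prod.fst (w i))) (one_mul (Prod.fst (w i)))
  rw [e] at h
  exact h

theorem sndVec_mem_Tor {n : ℕ} {C : Set (Fin n → RingE)} (hC : IsECode C) {w : Fin n → RingE}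
    (hw : w ∈ C) : sndVec w ∈ Tor C := by
  have h := hC.2.1 w hw _ (hC.2.2.2 RingE.kappa w hw)
  have e : (w + fun i => RingE.kappa * w i) = zetaVec (sndVec w) := by
    funext i
    refine Prod.ext ?_ ?_
    · show Prod.fst (w i) + 1 * Prod.fst (w i) = 0
      generalize Prod.fst (w i) = a
      revert a
      decide
    · show Prod.snd (w i) + 0 * Prod.fst (w i) = Prod.snd (w i)
      rw [zero_mul, add_zero]
  rw [e] at h
  exact h

end ECode

open ECode in
/-- `(RHull C)_Res = C_Res ∩ (C_Tor)^⊥` and `(RHull C)_Tor = C_Tor`. -/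
theorem residue_torsion_of_RHull {n : ℕ} (C : Set (Fin n → RingE)) (hC : IsECode C) :
    Res (RHull C) = Res C ∩ dualF (Tor C) ∧ Tor (RHull C) = Tor C := by
  refine ⟨?_, ?_⟩
  · ext v
    constructor
    · rintro ⟨z, ⟨hz, hd⟩, rfl⟩
      exact ⟨⟨z, hz, rfl⟩, (mem_dualR_iff hC z).1 hd⟩
    · rintro ⟨⟨z, hz, rfl⟩, hd⟩
      exact ⟨z, ⟨hz, (mem_dualR_iff hC z).2 hd⟩, rfl⟩
  · ext v
    constructor
    · intro h
      exact h.1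
    · intro h
      refine ⟨h, (mem_dualR_iff hC _).2 ?_⟩
      intro w _
      exact Finset.sum_eq_zero fun i _ => mul_zero (w i)
end

section
/- Let C be an E-linear code of length n. If C_Tor = F₂ⁿ, then (C^{⊥L})^{⊥R} = C; if moreover C_Res = {0}, then (C^{⊥R})^{⊥R} = C. -/
open scoped BigOperators

namespace ECode

theorem einner_eq_zero {n : ℕ} (w z : Fin n → RingE) :
    Einner w z = 0 ↔
      (∑ i, (w i).1 * (z i).1 = 0 ∧ ∑ i, (w i).2 * (z i).1 = 0) := by
  have h1 : (Einner w z).1 = ∑ i, (w i).1 * (z i).1 :=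
    map_sum (AddMonoidHom.fst (ZMod 2) (ZMod 2)) (fun i => (w i * z i : RingE)) Finset.univ
  have h2 : (Einner w z).2 = ∑ i, (w i).2 * (z i).1 :=
    map_sum (AddMonoidHom.snd (ZMod 2) (ZMod 2)) (fun i => (w i * z i : RingE)) Finset.univ
  rw [← h1, ← h2]
  exact Prod.ext_iff

/-- With full torsion, membership in the code only depends on the residue. -/
theorem mem_of_res {n : ℕ} {C : Set (Fin n → RingE)} (hC : IsECode C)
    (hTor : Tor C = Set.univ) {x : Fin n → RingE} (hx : piVec x ∈ Res C) : x ∈ C := by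
  obtain ⟨y, hy, hyx⟩ := hx
  have ht : zetaVec (fun i => (x i).2 - (y i).2) ∈ C := by
    have : (fun i => (x i).2 - (y i).2) ∈ Tor C := hTor ▸ Set.mem_univ _
    exact this
  have := hC.2.1 _ hy _ ht
  convert this using 1
  funext i
  have h1 : (y i).1 = (x i).1 := congrFun hyx i
  refine Prod.ext ?_ ?_
  · change (x i).1 = (y i).1 + 0
    rw [h1, add_zero]
  · change (x i).2 = (y i).2 + ((x i).2 - (y i).2)
    abel

/-- The residue code as a subspace. -/
def resSub {n : ℕ} (C : Set (Fin n → RingE)) (hC : IsECode C) :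
    Submodule (ZMod 2) (Fin n → ZMod 2) :=
  AddSubgroup.toZModSubmodule 2
    { carrier := Res C
      zero_mem' := ⟨0, hC.1, rfl⟩
      add_mem' := by
        rintro _ _ ⟨x, hx, rfl⟩ ⟨y, hy, rfl⟩
        exact ⟨x + y, hC.2.1 x hx y hy, rfl⟩
      neg_mem' := by
        rintro _ ⟨x, hx, rfl⟩
        exact ⟨-x, hC.2.2.1 x hx, rfl⟩ }

theorem exists_sep {n : ℕ} {C : Set (Fin n → RingE)} (hC : IsECode C)
    {v : Fin n → ZMod 2} (hv : v ∉ Res C) :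
    ∃ a : Fin n → ZMod 2, (∀ u ∈ Res C, ∑ i, a i * u i = 0) ∧ ∑ i, a i * v i ≠ 0 := by
  obtain ⟨f, hf, hle⟩ := Submodule.exists_le_ker_of_notMem (p := resSub C hC) (v := v) hv
  have key : ∀ u, ∑ i, f (Pi.single i 1) * u i = f u := by
    intro u
    rw [LinearMap.pi_apply_eq_sum_univ f u]
    refine Finset.sum_congr rfl fun i _ => ?_
    rw [smul_eq_mul, mul_comm]
    congr 2
    funext j
    simp [Pi.single_apply, eq_comm]
  refine ⟨fun i => f (Pi.single i 1), fun u hu => ?_, ?_⟩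
  · rw [key]
    exact hle hu
  · rw [key]
    exact hf

end ECode

open ECode in
/-- If `C_Tor = F₂ⁿ`, then `(C^{⊥L})^{⊥R} = C`; if moreover `C_Res = {0}`,
then `(C^{⊥R})^{⊥R} = C`. -/
theorem double_dual_right {n : ℕ} (C : Set (Fin n → RingE)) (hC : IsECode C)
    (hTor : Tor C = Set.univ) :
    dualR (dualL C) = C ∧ (Res C = {0} → dualR (dualR C) = C) := by
  constructor
  · ext x
    constructor
    · intro hx
      apply mem_of_res hC hTor
      by_contra hv
      obtain ⟨a, ha, hav⟩ := exists_sep hC hv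
      have hk : kappaVec a ∈ dualL C := by
        intro w hw
        rw [einner_eq_zero]
        exact ⟨ha _ ⟨w, hw, rfl⟩, Finset.sum_eq_zero fun i _ => zero_mul _⟩
      exact hav ((einner_eq_zero _ _).1 (hx _ hk)).1
    · intro hx w hw
      exact hw x hx
  · intro hRes
    have hC0 : ∀ x, x ∈ C ↔ ∀ i, (x i).1 = 0 := by
      intro x
      constructor
      · intro hx i
        have : piVec x ∈ Res C := ⟨x, hx, rfl⟩
        rw [hRes] at this
        exact congrFun this i
      · intro hx
        apply mem_of_res hC hTor
        rw [hRes]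
        exact funext hx
    have hD : dualR C = C := by
      ext z
      rw [hC0]
      constructor
      · intro hz i
        have hm : zetaVec (Pi.single i 1) ∈ C := (hC0 _).2 fun _ => rfl
        have h : ∑ j, (Pi.single i 1 : Fin n → ZMod 2) j * (z j).1 = 0 :=
          ((einner_eq_zero _ _).1 (hz _ hm)).2
        simpa [Pi.single_apply] using h
      · intro hz w _
        rw [einner_eq_zero]
        simp [hz]
    rw [hD, hD]
end
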